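/- The class O° of increasing oscillations, i.e., the pin class of the pin sequence 1(ru)^∞, has generating function f(z) = (1−z)/(1 − 2z − z³), and its growth rate κ ≈ 2.20557 is the reciprocal of the smallest positive real root of 1 − 2z − z³ = 0. -/

import Mathlib

/-- A *centred permutation*: `vals` is the one-line notation of the filled-in
permutation (length `n+1`), `origin` the index of the origin point. -/
structure CPerm where
  vals : List ℕ
  origin : ℕ
deriving DecidableEq

namespace CPerm

/-- Length of a centred permutation (origin does not count). -/
def len (p : CPerm) : ℕ := p.vals.length - 1

/-- A genuine centred permutation: one-line notation is a permutation of
`{0, …, N-1}` and the origin index is in range. -/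
def IsValid (p : CPerm) : Prop :=
  p.vals ≠ [] ∧ p.origin < p.vals.length ∧ p.vals.Perm (List.range p.vals.length)

def valAt (p : CPerm) (i : ℕ) : ℕ := p.vals.getD i 0

def originVal (p : CPerm) : ℕ := p.valAt p.origin

/-- The box-sum `p ⊞ q`: inflate the origin of `q` by a copy of `p`. -/
def boxSum (p q : CPerm) : CPerm :=
  let N := p.vals.length
  let v := q.originVal
  let shift : ℕ → ℕ := fun u => if u < v then u else u + (N - 1)
  ⟨(q.vals.take q.origin).map shift ++ p.vals.map (· + v) ++
      (q.vals.drop (q.origin + 1)).map shift,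
    q.origin + p.origin⟩

/-- The trivial centred permutation (origin only, length 0). -/
def trivial : CPerm := ⟨[0], 0⟩

/-- Iterated box-sum `σ₁ ⊞ σ₂ ⊞ ⋯ ⊞ σₙ`. -/
def boxSumList (l : List CPerm) : CPerm := l.foldr boxSum trivial

/-- `p` is ⊞-indecomposable: nonempty and not a box-sum of two strictly smaller
centred permutations. -/
def BoxIndecomposable (p : CPerm) : Prop :=
  1 ≤ p.len ∧
    ¬∃ a b : CPerm, a.IsValid ∧ b.IsValid ∧ 1 ≤ a.len ∧ 1 ≤ b.len ∧ boxSum a b = p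

/-- The non-origin point at index `i` of `p` lies in quadrant `q` (1–4,
numbered anticlockwise). -/
def InQuadrant (p : CPerm) (q : ℕ) (i : ℕ) : Prop :=
  i < p.vals.length ∧ i ≠ p.origin ∧
    ((q = 1 ∧ p.origin < i ∧ p.originVal < p.valAt i) ∨
     (q = 2 ∧ i < p.origin ∧ p.originVal < p.valAt i) ∨
     (q = 3 ∧ i < p.origin ∧ p.valAt i < p.originVal) ∨
     (q = 4 ∧ p.origin < i ∧ p.valAt i < p.originVal))

/-- All non-origin points of `p` lie in quadrant `q`. -/
def OneQuadrant (p : CPerm) (q : ℕ) : Prop :=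
  ∀ i, i < p.vals.length → i ≠ p.origin → InQuadrant p q i

def OppositeQuadrants (q₁ q₂ : ℕ) : Prop :=
  (q₁ = 1 ∧ q₂ = 3) ∨ (q₁ = 3 ∧ q₂ = 1) ∨ (q₁ = 2 ∧ q₂ = 4) ∨ (q₁ = 4 ∧ q₂ = 2)

/-- Centred pattern containment `p ≤ q` (origins must match up). -/
def PatternLE (p q : CPerm) : Prop :=
  ∃ f : ℕ → ℕ,
    (∀ i j, i < p.vals.length → j < p.vals.length → i < j → f i < f j) ∧
    (∀ i, i < p.vals.length → f i < q.vals.length) ∧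
    f p.origin = q.origin ∧
    (∀ i j, i < p.vals.length → j < p.vals.length →
      (p.valAt i < p.valAt j ↔ q.valAt (f i) < q.valAt (f j)))

/-- A centred permutation class: nonempty, consisting of valid centred
permutations, and downward closed under centred containment. -/
def IsClass (S : Set CPerm) : Prop :=
  S.Nonempty ∧ (∀ p ∈ S, p.IsValid) ∧
    ∀ p q : CPerm, q ∈ S → p.IsValid → PatternLE p q → p ∈ S

/-- `S` is closed under the box-sum. -/
def BoxClosed (S : Set CPerm) : Prop := ∀ p ∈ S, ∀ q ∈ S, boxSum p q ∈ S

/-- Number of centred permutations of length `n` in `S`. -/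
noncomputable def count (S : Set CPerm) (n : ℕ) : ℕ := {p | p ∈ S ∧ p.len = n}.ncard

/-- The single-point centred permutation in quadrant `q`. -/
def mu : ℕ → CPerm
  | 1 => ⟨[0, 1], 0⟩
  | 2 => ⟨[1, 0], 1⟩
  | 3 => ⟨[0, 1], 1⟩
  | 4 => ⟨[1, 0], 0⟩
  | _ => ⟨[0], 0⟩

def AdjacentQuadrants (a b : ℕ) : Prop :=
  (a, b) = (1, 2) ∨ (a, b) = (2, 3) ∨ (a, b) = (3, 4) ∨ (a, b) = (4, 1) ∨
  (a, b) = (2, 1) ∨ (a, b) = (3, 2) ∨ (a, b) = (4, 3) ∨ (a, b) = (1, 4)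

/-- The adjacency condition on a centred class. -/
def AdjacencyCondition (S : Set CPerm) : Prop :=
  (∃! q : ℕ, q ∈ ({1, 2, 3, 4} : Set ℕ) ∧ mu q ∈ S) ∨
    ∃ a b : ℕ, AdjacentQuadrants a b ∧ mu a ∈ S ∧ mu b ∈ S

end CPerm

inductive PinLetter | u | d | l | r
deriving DecidableEq

def PinLetter.isVert : PinLetter → Bool
  | .u => true
  | .d => true
  | .l => false
  | .r => false

/-- Letters strictly alternate between vertical and horizontal alignment. -/
def PinAlt (ls : List PinLetter) : Prop :=
  List.Chain' (fun a b => a.isVert ≠ b.isVert) ls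

/-- A pin word: an initial numeral `q ∈ {1,…,4}` followed by alternating letters. -/
def IsPinWord (q : ℕ) (ls : List PinLetter) : Prop := 1 ≤ q ∧ q ≤ 4 ∧ PinAlt ls

def firstPt : ℕ → ℚ × ℚ
  | 1 => (1, 1)
  | 2 => (-1, 1)
  | 3 => (-1, -1)
  | 4 => (1, -1)
  | _ => (1, 1)

def maxOf (l : List ℚ) : ℚ := l.foldr max 0
def minOf (l : List ℚ) : ℚ := l.foldr min 0

/-- Place the next pin: beyond the bounding rectangle in the given direction,
separating the previous point from all the others. The list holds the points
newest-first; the origin `(0,0)` is the last entry. -/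
def pinStep (pts : List (ℚ × ℚ)) (dir : PinLetter) : List (ℚ × ℚ) :=
  let last := pts.headD (0, 0)
  let rest := pts.tail
  let btwY : ℚ :=
    if maxOf (rest.map Prod.snd) < last.2 then (last.2 + maxOf (rest.map Prod.snd)) / 2
    else (last.2 + minOf (rest.map Prod.snd)) / 2
  let btwX : ℚ :=
    if maxOf (rest.map Prod.fst) < last.1 then (last.1 + maxOf (rest.map Prod.fst)) / 2
    else (last.1 + minOf (rest.map Prod.fst)) / 2
  let np : ℚ × ℚ :=
    match dir with
    | .r => (maxOf (pts.map Prod.fst) + 1, btwY)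
    | .l => (minOf (pts.map Prod.fst) - 1, btwY)
    | .u => (btwX, maxOf (pts.map Prod.snd) + 1)
    | .d => (btwX, minOf (pts.map Prod.snd) - 1)
  np :: pts

/-- The points (newest first, origin last) drawn from a pin word. -/
def pinPts (q : ℕ) (ls : List PinLetter) : List (ℚ × ℚ) :=
  ls.foldl pinStep [firstPt q, (0, 0)]

/-- Convert a finite set of plane points (with origin `(0,0)`) into a centred
permutation in canonical form. -/
def toCPerm (pts : List (ℚ × ℚ)) : CPerm :=
  ⟨(pts.mergeSort (fun a b => decide (a.1 ≤ b.1))).map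
      (fun pt => ((pts.map Prod.snd).filter (fun y => decide (y < pt.2))).length),
    ((pts.map Prod.fst).filter (fun x => decide (x < 0))).length⟩

/-- The centred pin permutation of a pin word. -/
def pinPerm (q : ℕ) (ls : List PinLetter) : CPerm := toCPerm (pinPts q ls)

/-- The complete pin class `P°`: the downward closure of all box-sums of
centred pin permutations. -/
def CompletePinClass : Set CPerm :=
  {p | p.IsValid ∧
    ∃ ws : List (ℕ × List PinLetter), (∀ w ∈ ws, IsPinWord w.1 w.2) ∧
      CPerm.PatternLE p (CPerm.boxSumList (ws.map fun w => pinPerm w.1 w.2))}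

/-- An infinite pin sequence: numeral `q` and letters `f 0, f 1, …`,
alternating in alignment. -/
def IsPinSeq (q : ℕ) (f : ℕ → PinLetter) : Prop :=
  1 ≤ q ∧ q ≤ 4 ∧ ∀ n, (f n).isVert ≠ (f (n + 1)).isVert

def seqPrefix (f : ℕ → PinLetter) (n : ℕ) : List PinLetter := (List.range n).map f

/-- The pin class of an infinite pin sequence. -/
def PinClassOf (q : ℕ) (f : ℕ → PinLetter) : Set CPerm :=
  {p | p.IsValid ∧ ∃ n : ℕ, CPerm.PatternLE p (pinPerm q (seqPrefix f n))}

/-- The `i`-th point (`i ≥ 1`) placed when drawing the pin sequence. -/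
def seqPoint (q : ℕ) (f : ℕ → PinLetter) (i : ℕ) : ℚ × ℚ :=
  (pinPts q (seqPrefix f (i - 1))).headD (0, 0)

/-- The quadrant of a plane point. -/
def quadOf (pt : ℚ × ℚ) : ℕ :=
  if 0 < pt.1 then (if 0 < pt.2 then 1 else 4) else (if 0 < pt.2 then 2 else 3)

/-- The pin word `w` is the pin factor of the sequence starting at position `i ≥ 1`
(first letter replaced by the quadrant of the corresponding point). -/
def FactorAt (q : ℕ) (f : ℕ → PinLetter) (i : ℕ) (w : ℕ × List PinLetter) : Prop :=
  1 ≤ i ∧ w.1 = quadOf (seqPoint q f i) ∧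
    ∀ t, t < w.2.length → w.2.getD t PinLetter.u = f (i - 1 + t)

/-- A recurrent pin factor: one occurring arbitrarily late. -/
def RecurrentFactor (q : ℕ) (f : ℕ → PinLetter) (w : ℕ × List PinLetter) : Prop :=
  ∀ N : ℕ, ∃ i, N ≤ i ∧ FactorAt q f i w

/-- The ⊞-interior of a pin class: the ⊞-closure (as a class) of the
permutations generated by recurrent pin factors. -/
def BoxInterior (q : ℕ) (f : ℕ → PinLetter) : Set CPerm :=
  {p | p.IsValid ∧
    ∃ l : List CPerm,
      (∀ x ∈ l, ∃ w : ℕ × List PinLetter, RecurrentFactor q f w ∧ x = pinPerm w.1 w.2) ∧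
      CPerm.PatternLE p (CPerm.boxSumList l)}

open Filter PowerSeries

/-- The pin sequence `1(ru)^∞` defining the increasing oscillations. -/
def oscLetters : ℕ → PinLetter := fun n => if n % 2 = 0 then PinLetter.r else PinLetter.u

/-- The class `O°` of increasing oscillations: the pin class of `1(ru)^∞`. -/
def IncreasingOscillations : Set CPerm := PinClassOf 1 oscLetters

/-! ### Analytic part -/

theorem osc_genfun_aux (a : ℕ → ℕ) (h0 : a 0 = 1) (h1 : a 1 = 1) (h2 : a 2 = 2)
    (hr : ∀ n, a (n + 3) = 2 * a (n + 2) + a n) :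
    (PowerSeries.mk fun n => (a n : ℝ)) *
        (1 - 2 * (PowerSeries.X : PowerSeries ℝ) - (PowerSeries.X : PowerSeries ℝ) ^ 3) =
      1 - (PowerSeries.X : PowerSeries ℝ) := by
  have e : (PowerSeries.mk fun n => (a n : ℝ)) *
        (1 - 2 * (PowerSeries.X : PowerSeries ℝ) - (PowerSeries.X : PowerSeries ℝ) ^ 3)
      = (PowerSeries.mk fun n => (a n : ℝ)) - (PowerSeries.mk fun n => 2 * (a n : ℝ)) * PowerSeries.X
        - (PowerSeries.mk fun n => (a n : ℝ)) * PowerSeries.X ^ 3 := by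
    have : (PowerSeries.mk fun n => 2 * (a n : ℝ)) = 2 * (PowerSeries.mk fun n => (a n : ℝ)) := by
      ext n
      rw [two_mul, map_add]
      simp [two_mul]
    rw [this]; ring
  rw [e]
  ext n
  rcases n with _ | _ | _ | n
  · simp [h0]
  · simp only [map_sub, PowerSeries.coeff_succ_mul_X, PowerSeries.coeff_mul_X_pow', PowerSeries.coeff_mk]
    simp [h0, h1, PowerSeries.coeff_one, PowerSeries.coeff_X]; norm_num
  · simp only [map_sub, PowerSeries.coeff_succ_mul_X, PowerSeries.coeff_mul_X_pow', PowerSeries.coeff_mk]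
    simp [h1, h2, PowerSeries.coeff_one, PowerSeries.coeff_X]
  · simp only [map_sub, PowerSeries.coeff_succ_mul_X, PowerSeries.coeff_mul_X_pow', PowerSeries.coeff_mk]
    simp [hr, PowerSeries.coeff_one, PowerSeries.coeff_X]

theorem osc_growth_aux (a : ℕ → ℕ) (h0 : a 0 = 1) (h1 : a 1 = 1) (h2 : a 2 = 2)
    (hr : ∀ n, a (n + 3) = 2 * a (n + 2) + a n) (α : ℝ) (hα : 0 < α)
    (hroot : 1 - 2 * α - α ^ 3 = 0) :
    Tendsto (fun n : ℕ => ((a n : ℝ)) ^ ((n : ℝ)⁻¹)) atTop (nhds α⁻¹) := by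
  have hα2 : α < 1 / 2 := by nlinarith [pow_pos hα 3]
  set k := α⁻¹ with hk
  have hk0 : 0 < k := inv_pos.mpr hα
  have hka : k * α = 1 := inv_mul_cancel₀ hα.ne'
  have hk2 : 2 < k := by
    by_contra h
    push Not at h
    nlinarith
  have hk3 : k ^ 3 = 2 * k ^ 2 + 1 := by
    have : k ^ 3 * (1 - 2 * α - α ^ 3) = k ^ 3 - 2 * k ^ 2 * (k * α) - (k * α) ^ 3 := by ring
    rw [hroot, hka] at this
    linarith
  have up : ∀ n, (a n : ℝ) ≤ k ^ n ∧ (a (n+1) : ℝ) ≤ k ^ (n+1) ∧ (a (n+2) : ℝ) ≤ k ^ (n+2) := by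
    intro n
    induction n with
    | zero => simp [h0, h1, h2]; constructor <;> nlinarith
    | succ n ih =>
      obtain ⟨i1, i2, i3⟩ := ih
      refine ⟨i2, i3, ?_⟩
      have : k ^ (n + 1 + 2) = 2 * k ^ (n+2) + k ^ n := by
        have : k ^ (n + 1 + 2) = k ^ n * k ^ 3 := by ring
        rw [this, hk3]; ring
      rw [this, show n + 1 + 2 = n + 3 from rfl, hr]
      push_cast
      linarith
  have lo : ∀ n, α ^ 2 * k ^ n ≤ (a n : ℝ) ∧ α ^ 2 * k ^ (n+1) ≤ (a (n+1) : ℝ) ∧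
      α ^ 2 * k ^ (n+2) ≤ (a (n+2) : ℝ) := by
    intro n
    induction n with
    | zero =>
      refine ⟨?_, ?_, ?_⟩
      · simp only [pow_zero, mul_one, h0, Nat.cast_one]; nlinarith
      · simp [h1]; nlinarith
      · have : α ^ 2 * k ^ 2 = (k * α) ^ 2 := by ring
        simp [h2, this, hka]
    | succ n ih =>
      obtain ⟨i1, i2, i3⟩ := ih
      refine ⟨i2, i3, ?_⟩
      have : k ^ (n + 1 + 2) = 2 * k ^ (n+2) + k ^ n := by
        have : k ^ (n + 1 + 2) = k ^ n * k ^ 3 := by ring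
        rw [this, hk3]; ring
      rw [this, show n + 1 + 2 = n + 3 from rfl, hr]
      push_cast
      linarith
  have hlow : Tendsto (fun n : ℕ => (α ^ 2) ^ ((n : ℝ)⁻¹) * k) atTop (nhds k) := by
    have h : Tendsto (fun n : ℕ => (α ^ 2) ^ ((n : ℝ)⁻¹)) atTop (nhds ((α ^ 2) ^ (0:ℝ))) := by
      apply Tendsto.rpow tendsto_const_nhds
      · exact tendsto_inv_atTop_zero.comp tendsto_natCast_atTop_atTop
      · left; positivity
    simpa using h.mul_const k
  refine tendsto_of_tendsto_of_tendsto_of_le_of_le' hlow tendsto_const_nhds ?_ ?_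
  · filter_upwards [eventually_ge_atTop 1] with n hn
    have : (α ^ 2) ^ ((n : ℝ)⁻¹) * k = (α ^ 2 * k ^ n) ^ ((n : ℝ)⁻¹) := by
      rw [Real.mul_rpow (by positivity) (by positivity), Real.pow_rpow_inv_natCast hk0.le (by omega)]
    rw [this]
    exact Real.rpow_le_rpow (by positivity) (lo n).1 (by positivity)
  · filter_upwards [eventually_ge_atTop 1] with n hn
    calc ((a n : ℝ)) ^ ((n : ℝ)⁻¹) ≤ (k ^ n) ^ ((n : ℝ)⁻¹) :=
          Real.rpow_le_rpow (by positivity) (up n).1 (by positivity)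
      _ = k := Real.pow_rpow_inv_natCast hk0.le (by omega)

/-! ### The points of the oscillation -/

/-- Doubled `x`-coordinate of the `k`-th point (index `0` is the origin). -/
def oX (k : ℕ) : ℕ := if k = 0 then 0 else if k = 1 then 2 else if k % 2 = 0 then k + 2 else k

/-- Doubled `y`-coordinate of the `k`-th point. -/
def oY (k : ℕ) : ℕ := if k % 2 = 0 then k - 1 else k + 1

def oPt (k : ℕ) : ℚ × ℚ := ((oX k : ℚ) / 2, (oY k : ℚ) / 2)

theorem oX_inj {i j : ℕ} (h : oX i = oX j) : i = j := by
  unfold oX at h; split_ifs at h <;> omega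

theorem oY_inj {i j : ℕ} (h : oY i = oY j) : i = j := by
  unfold oY at h; split_ifs at h <;> omega

def oR (k : ℕ) : List (ℚ × ℚ) := ((List.range k).reverse).map oPt

theorem oR_succ (k : ℕ) : oR (k + 1) = oPt k :: oR k := by
  simp [oR, List.range_succ]

theorem max_half (a b : ℕ) : max ((a : ℚ) / 2) ((b : ℚ) / 2) = ((max a b : ℕ) : ℚ) / 2 := by
  rw [Nat.cast_max, max_div_div_right (by norm_num)]

theorem maxX_oR (k : ℕ) : maxOf ((oR (k + 1)).map Prod.fst) =
    ((if k = 0 then 0 else 2 * ((k + 2) / 2) : ℕ) : ℚ) / 2 := by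
  induction k with
  | zero => simp [oR, maxOf, oPt, oX]
  | succ k ih =>
    rw [oR_succ]
    unfold maxOf at ih ⊢
    rw [List.map_cons, List.foldr_cons, ih]
    show max ((oX (k+1) : ℚ) / 2) _ = _
    rw [max_half]
    congr 2
    unfold oX
    split_ifs <;> first | omega | contradiction

theorem maxY_oR (k : ℕ) : maxOf ((oR (k + 1)).map Prod.snd) =
    ((2 * ((k + 1) / 2) : ℕ) : ℚ) / 2 := by
  induction k with
  | zero => simp [oR, maxOf, oPt, oY]
  | succ k ih =>
    rw [oR_succ]
    unfold maxOf at ih ⊢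
    rw [List.map_cons, List.foldr_cons, ih]
    show max ((oY (k+1) : ℚ) / 2) _ = _
    rw [max_half]
    congr 2
    unfold oY
    split_ifs <;> omega

theorem pinStep_oR (n : ℕ) : pinStep (oR (n + 2)) (oscLetters n) = oR (n + 3) := by
  rw [oR_succ (n + 2)]
  unfold pinStep
  simp only [List.cons.injEq, and_true]
  rw [show (oR (n+2)).headD (0,0) = oPt (n+1) by rw [oR_succ]; rfl,
    show (oR (n+2)).tail = oR (n+1) by rw [oR_succ]; rfl,
    maxX_oR n, maxY_oR n, maxX_oR (n+1), maxY_oR (n+1)]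
  unfold oscLetters
  rcases Nat.even_or_odd' n with ⟨m, rfl | rfl⟩
  · have e1 : oY (2 * m + 1) = 2 * m + 2 := by unfold oY; split_ifs <;> omega
    have e2 : oX (2 * m + 2) = 2 * m + 4 := by unfold oX; split_ifs <;> omega
    have e3 : oY (2 * m + 2) = 2 * m + 1 := by unfold oY; split_ifs <;> omega
    have e4 : (2 * m + 1) / 2 = m := by omega
    have e5 : (2 * m + 1 + 2) / 2 = m + 1 := by omega
    simp only [oPt, e1, e2, e3, e4, e5]
    have : (((2 * m : ℕ) : ℚ) / 2) < ((2 * m + 2 : ℕ) : ℚ) / 2 := by push_cast; linarith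
    rw [if_pos this]
    simp
    constructor <;> ring
  · have e1 : oX (2 * m + 1 + 1) = 2 * m + 4 := by unfold oX; split_ifs <;> omega
    have e2 : oX (2 * m + 1 + 2) = 2 * m + 3 := by unfold oX; split_ifs <;> omega
    have e3 : oY (2 * m + 1 + 2) = 2 * m + 4 := by unfold oY; split_ifs <;> omega
    have e4 : (2 * m + 1 + 2) / 2 = m + 1 := by omega
    have e5 : (2 * m + 1 + 1 + 1) / 2 = m + 1 := by omega
    have e6 : (2 * m + 1) % 2 = 1 := by omega
    simp only [oPt, e1, e2, e3, e4, e6]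
    have : (((2 * (m + 1) : ℕ) : ℚ) / 2) < ((2 * m + 4 : ℕ) : ℚ) / 2 := by push_cast; linarith
    simp only [Nat.succ_ne_zero, if_false, one_ne_zero]
    rw [if_pos this]
    simp
    constructor <;> ring

theorem pinPts_osc (n : ℕ) : pinPts 1 (seqPrefix oscLetters n) = oR (n + 2) := by
  induction n with
  | zero =>
    simp [pinPts, seqPrefix, oR, List.range_succ, oPt, oX, oY, firstPt]
  | succ n ih =>
    have : seqPrefix oscLetters (n + 1) = seqPrefix oscLetters n ++ [oscLetters n] := by
      simp [seqPrefix, List.range_succ]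
    unfold pinPts at ih ⊢
    rw [this, List.foldl_append, ih]
    exact pinStep_oR n

theorem filter_len_lt {l : List ℚ} {a b : ℚ} (ha : a ∈ l) (hab : a < b) :
    (l.filter (fun y => decide (y < a))).length < (l.filter (fun y => decide (y < b))).length := by
  induction l with
  | nil => simp at ha
  | cons c l ih =>
    have mono : (l.filter (fun y => decide (y < a))).length ≤
        (l.filter (fun y => decide (y < b))).length := by
      apply List.Sublist.length_le
      apply List.monotone_filter_right
      intro y hy
      simp only [decide_eq_true_eq] at hy ⊢
      exact hy.trans hab
    rcases List.mem_cons.mp ha with rfl | h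
    · simp only [List.filter_cons, lt_irrefl, hab, decide_true, decide_false, if_true]
      simp; omega
    · have := ih h
      by_cases h1 : c < a
      · simp [h1, h1.trans hab]; simpa using this
      · by_cases h2 : c < b
        · simp only [List.filter_cons, h1, h2, decide_true, decide_false, if_true]
          simp only [Bool.false_eq_true, if_false, List.length_cons]; omega
        · simp only [List.filter_cons, h1, h2, decide_false]
          simpa using this

theorem pinPerm_osc_spec (n : ℕ) : ∃ idx : ℕ → ℕ,
    (pinPerm 1 (seqPrefix oscLetters n)).vals.length = n + 2 ∧
    (pinPerm 1 (seqPrefix oscLetters n)).origin = 0 ∧ idx 0 = 0 ∧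
    (∀ i < n + 2, idx i < n + 2) ∧
    (∀ i j, i < j → j < n + 2 → oX (idx i) < oX (idx j)) ∧
    (∀ i j, i < n + 2 → j < n + 2 →
      ((pinPerm 1 (seqPrefix oscLetters n)).valAt i < (pinPerm 1 (seqPrefix oscLetters n)).valAt j
        ↔ oY (idx i) < oY (idx j))) ∧
    (∀ m < n + 2, ∃ i < n + 2, idx i = m) := by
  unfold pinPerm
  rw [pinPts_osc]
  generalize hN : n + 2 = N
  set S := (oR N).mergeSort (fun a b => decide (a.1 ≤ b.1)) with hS
  have hperm : S.Perm (oR N) := List.mergeSort_perm _ _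
  have hlen : S.length = N := by rw [hperm.length_eq]; simp [oR]
  have hsort : S.Pairwise (fun a b => a.1 ≤ b.1) := by
    have := List.pairwise_mergeSort (le := fun a b : ℚ × ℚ => decide (a.1 ≤ b.1))
      (fun a b c h1 h2 => by simp at *; exact h1.trans h2)
      (fun a b => by simp; exact le_total _ _) (oR N)
    simpa using this
  have hmem : ∀ p, p ∈ S ↔ ∃ m < N, oPt m = p := by
    intro p; rw [hperm.mem_iff]; simp [oR]
  have oPt_inj : ∀ i j, (oPt i).1 = (oPt j).1 → i = j := by
    intro i j h
    apply oX_inj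
    simp only [oPt] at h
    have : (oX i : ℚ) = oX j := by linarith
    exact_mod_cast this
  have hnodup : S.Nodup := by
    rw [hperm.nodup_iff]
    unfold oR
    apply List.Nodup.map
    · intro i j h; exact oPt_inj i j (by rw [h])
    · simpa using List.nodup_range
  have hex : ∀ i, ∃ m, ∀ (h : i < S.length), m < N ∧ oPt m = S[i] := by
    intro i
    by_cases h : i < S.length
    · obtain ⟨m, hm⟩ := (hmem _).1 (List.getElem_mem h)
      exact ⟨m, fun _ => hm⟩
    · exact ⟨0, fun h' => absurd h' h⟩
  choose idx hidx using hex
  have hXX : ∀ i j, i < j → j < N → oX (idx i) < oX (idx j) := by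
    intro i j hij hj
    have hi' : i < S.length := by omega
    have hj' : j < S.length := by omega
    have h1 := List.pairwise_iff_getElem.1 hsort i j hi' hj' hij
    rw [← (hidx i hi').2, ← (hidx j hj').2] at h1
    have h2 : oX (idx i) ≤ oX (idx j) := by
      simp only [oPt] at h1
      have : (oX (idx i) : ℚ) ≤ oX (idx j) := by linarith
      exact_mod_cast this
    rcases h2.lt_or_eq with h | h
    · exact h
    · have h3 := oX_inj h
      have h4 : S[i] = S[j] := by rw [← (hidx i hi').2, ← (hidx j hj').2, h3]
      have := (hnodup.getElem_inj_iff).1 h4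
      omega
  have hsurj : ∀ m < N, ∃ i < N, idx i = m := by
    intro m hm
    obtain ⟨i, hi, h⟩ := List.getElem_of_mem ((hmem (oPt m)).2 ⟨m, hm, rfl⟩)
    refine ⟨i, by omega, ?_⟩
    apply oPt_inj
    rw [(hidx i hi).2, h]
  refine ⟨idx, ?_, ?_, ?_, ?_, hXX, ?_, hsurj⟩
  · simp [toCPerm, oR]
  · simp only [toCPerm, List.length_eq_zero_iff, List.filter_eq_nil_iff]
    intro x hx
    simp only [oR, List.map_map, List.mem_map] at hx
    obtain ⟨m, _, rfl⟩ := hx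
    have : 0 ≤ (oPt m).1 := by unfold oPt; positivity
    simpa using this
  · obtain ⟨i, hi, h⟩ := hsurj 0 (by omega)
    rcases Nat.eq_zero_or_pos i with rfl | hp
    · exact h
    · have := hXX 0 i hp hi
      rw [h] at this
      simp [oX] at this
  · intro i hi; exact (hidx i (by omega)).1
  · have hval : ∀ i < N, (toCPerm (oR N)).valAt i =
        (((oR N).map Prod.snd).filter (fun y => decide (y < (oPt (idx i)).2))).length := by
      intro i hi
      have hi' : i < S.length := by omega
      have h1 : (toCPerm (oR N)).vals = S.map
        (fun pt => (((oR N).map Prod.snd).filter (fun y => decide (y < pt.2))).length) := rfl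
      unfold CPerm.valAt
      rw [h1, List.getD_eq_getElem _ _ (by simpa using hi'), List.getElem_map, (hidx i hi').2]
    have key : ∀ i j, i < N → j < N → oY (idx i) < oY (idx j) →
        (toCPerm (oR N)).valAt i < (toCPerm (oR N)).valAt j := by
      intro i j hi hj h
      rw [hval i hi, hval j hj]
      apply filter_len_lt
      · rw [List.mem_map]
        exact ⟨oPt (idx i), by simpa [oR] using ⟨idx i, (hidx i (by omega)).1, rfl⟩, rfl⟩
      · have : (oY (idx i) : ℚ) < oY (idx j) := by exact_mod_cast h
        simp only [oPt]; linarith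
    intro i j hi hj
    refine ⟨fun h => ?_, key i j hi hj⟩
    by_contra hc
    rcases (not_lt.1 hc).lt_or_eq with h' | h'
    · have := key j i hj hi h'; omega
    · have := oY_inj h'
      rw [hval i hi, hval j hj, this] at h
      omega

/-! ### The recursive description of the patterns -/

def oBump (n v : ℕ) : ℕ := if v = n then n + 1 else v

def opS (n : ℕ) (w : List ℕ) : List ℕ := (n + 1) :: w

def opT (n : ℕ) : List ℕ → List ℕ
  | [] => []
  | x :: a => x :: (n + 1) :: a

def opR (n : ℕ) (w : List ℕ) : List ℕ := n :: w.map (oBump n)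

structure OSt where
  all : Finset (List ℕ)
  one : Finset (List ℕ)
  two : Finset (List ℕ)
  top : Finset (List ℕ)
  rgt : Finset (List ℕ)

def oNext (n : ℕ) (s : OSt) : OSt :=
  ⟨s.all.image (opS n) ∪ s.one.image (opT n) ∪ (s.two ∪ s.rgt).image (opT n) ∪
      (s.two ∪ s.top).image (opR n),
    s.all.image (opS n), s.one.image (opT n), (s.two ∪ s.rgt).image (opT n),
    (s.two ∪ s.top).image (opR n)⟩

/-- Reversed one-line notations of the patterns of length `n`, by type of the last block. -/
def oSt : ℕ → OSt
  | 0 => ⟨{[0]}, ∅, ∅, ∅, ∅⟩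
  | n + 1 => oNext n (oSt n)

theorem oSt_sub (n : ℕ) : (oSt n).one ⊆ (oSt n).all ∧ (oSt n).two ⊆ (oSt n).all ∧
    (oSt n).top ⊆ (oSt n).all ∧ (oSt n).rgt ⊆ (oSt n).all := by
  cases n with
  | zero => simp [oSt]
  | succ n =>
    refine ⟨?_, ?_, ?_, ?_⟩ <;> intro w hw <;> simp only [oSt, oNext, Finset.mem_union] at hw ⊢ <;> tauto

theorem opS_perm {n : ℕ} {w : List ℕ} (h : w.Perm (List.range (n + 1))) :
    (opS n w).Perm (List.range (n + 2)) := by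
  rw [List.range_succ]
  exact (h.cons _).trans (List.perm_append_singleton _ _).symm

theorem opT_perm {n : ℕ} {w : List ℕ} (h : w.Perm (List.range (n + 1))) :
    (opT n w).Perm (List.range (n + 2)) := by
  cases w with
  | nil => have := h.length_eq; simp at this
  | cons x a => exact (List.Perm.swap _ _ _).trans (opS_perm h)

theorem opR_perm {n : ℕ} {w : List ℕ} (h : w.Perm (List.range (n + 1))) :
    (opR n w).Perm (List.range (n + 2)) := by
  have h1 : (w.map (oBump n)).Perm (List.range n ++ [n + 1]) := by
    have h2 := h.map (oBump n)
    rw [List.range_succ, List.map_append] at h2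
    have h3 : (List.range n).map (oBump n) = List.range n := by
      conv_rhs => rw [← List.map_id (List.range n)]
      apply List.map_congr_left
      intro a ha
      have := List.mem_range.1 ha
      simp [oBump]; omega
    rw [h3] at h2
    simpa [oBump] using h2
  rw [List.range_succ, List.range_succ]
  refine (h1.cons n).trans ?_
  rw [← List.cons_append]
  exact (List.perm_append_singleton _ _).symm.append_right _

theorem oSt_perm (n : ℕ) : ∀ w ∈ (oSt n).all, w.Perm (List.range (n + 1)) := by
  induction n with
  | zero => simp [oSt]
  | succ n ih =>
    obtain ⟨s1, s2, s3, s4⟩ := oSt_sub n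
    intro w hw
    simp only [oSt, oNext, Finset.mem_union, Finset.mem_image] at hw
    rcases hw with ((⟨v, hv, rfl⟩ | ⟨v, hv, rfl⟩) | ⟨v, hv, rfl⟩) | ⟨v, hv, rfl⟩
    · exact opS_perm (ih v hv)
    · exact opT_perm (ih v (s1 hv))
    · exact opT_perm (ih v (by rcases hv with h | h; exacts [s2 h, s4 h]))
    · exact opR_perm (ih v (by rcases hv with h | h; exacts [s2 h, s3 h]))

theorem oSt_shape (n : ℕ) :
    (∀ w ∈ (oSt n).one, ∃ a, w = n :: a) ∧
    (∀ w ∈ (oSt n).two, ∃ k a, n = k + 1 ∧ w = k :: n :: a) ∧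
    (∀ w ∈ (oSt n).top, ∃ x a, x + 1 < n ∧ w = x :: n :: a) ∧
    (∀ w ∈ (oSt n).rgt, ∃ k y a, n = k + 1 ∧ y ≠ n ∧ w = k :: y :: a) := by
  induction n with
  | zero => simp [oSt]
  | succ n ih =>
    obtain ⟨i1, i2, i3, i4⟩ := ih
    refine ⟨?_, ?_, ?_, ?_⟩ <;> intro w hw <;>
      simp only [oSt, oNext, Finset.mem_union, Finset.mem_image] at hw <;>
      obtain ⟨v, hv, rfl⟩ := hw
    · exact ⟨v, rfl⟩
    · obtain ⟨a, rfl⟩ := i1 v hv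
      exact ⟨n, a, rfl, rfl⟩
    · rcases hv with hv | hv
      · obtain ⟨k, a, hk, rfl⟩ := i2 v hv
        exact ⟨k, _, by omega, rfl⟩
      · obtain ⟨k, y, a, hk, hy, rfl⟩ := i4 v hv
        exact ⟨k, _, by omega, rfl⟩
    · rcases hv with hv | hv
      · obtain ⟨k, a, hk, rfl⟩ := i2 v hv
        refine ⟨n, oBump n k, _, rfl, ?_, rfl⟩
        unfold oBump; split_ifs <;> omega
      · obtain ⟨x, a, hx, rfl⟩ := i3 v hv
        refine ⟨n, oBump n x, _, rfl, ?_, rfl⟩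
        unfold oBump; split_ifs <;> omega

theorem opT_injOn {n : ℕ} {s : Finset (List ℕ)} (hs : s ⊆ (oSt n).all) :
    Set.InjOn (opT n) s := by
  intro v hv w hw h
  have h1 := (oSt_perm n v (hs hv)).length_eq
  have h2 := (oSt_perm n w (hs hw)).length_eq
  cases v <;> cases w <;> simp [opT] at *
  exact h

theorem opR_injOn {n : ℕ} {s : Finset (List ℕ)} (hs : s ⊆ (oSt n).all) :
    Set.InjOn (opR n) s := by
  have key : ∀ v ∈ s, (v.map (oBump n)).map (fun u => if u = n + 1 then n else u) = v := by
    intro v hv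
    have hp := oSt_perm n v (hs hv)
    rw [List.map_map]
    conv_rhs => rw [← List.map_id v]
    apply List.map_congr_left
    intro a ha
    have : a < n + 1 := by simpa using hp.mem_iff.1 ha
    simp only [Function.comp, oBump, id]
    split_ifs <;> omega
  intro v hv w hw h
  have h' := (List.cons.inj h).2
  rw [← key v hv, ← key w hw, h']

theorem oSt_card_succ (n : ℕ) :
    (oSt (n + 1)).one.card = (oSt n).all.card ∧
    (oSt (n + 1)).two.card = (oSt n).one.card ∧
    (oSt (n + 1)).top.card = (oSt n).two.card + (oSt n).rgt.card ∧
    (oSt (n + 1)).rgt.card = (oSt n).two.card + (oSt n).top.card ∧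
    (oSt (n + 1)).all.card = (oSt (n + 1)).one.card + (oSt (n + 1)).two.card +
      (oSt (n + 1)).top.card + (oSt (n + 1)).rgt.card := by
  obtain ⟨s1, s2, s3, s4⟩ := oSt_sub n
  obtain ⟨i1, i2, i3, i4⟩ := oSt_shape n
  obtain ⟨j1, j2, j3, j4⟩ := oSt_shape (n + 1)
  refine ⟨?_, ?_, ?_, ?_, ?_⟩
  · exact Finset.card_image_of_injective _ (List.cons_injective)
  · exact Finset.card_image_of_injOn (opT_injOn s1)
  · have : (oSt (n + 1)).top.card = ((oSt n).two ∪ (oSt n).rgt).card :=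
      Finset.card_image_of_injOn (opT_injOn (Finset.union_subset s2 s4))
    rw [this]
    apply Finset.card_union_of_disjoint
    rw [Finset.disjoint_left]
    intro w h1 h2
    obtain ⟨k, a, hk, rfl⟩ := i2 w h1
    obtain ⟨k', y, a', hk', hy, h⟩ := i4 _ h2
    simp at h; omega
  · have : (oSt (n + 1)).rgt.card = ((oSt n).two ∪ (oSt n).top).card :=
      Finset.card_image_of_injOn (opR_injOn (Finset.union_subset s2 s3))
    rw [this]
    apply Finset.card_union_of_disjoint
    rw [Finset.disjoint_left]
    intro w h1 h2
    obtain ⟨k, a, hk, rfl⟩ := i2 w h1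
    obtain ⟨x, a', hx, h⟩ := i3 _ h2
    simp at h; omega
  · have : (oSt (n + 1)).all = (oSt (n + 1)).one ∪ (oSt (n + 1)).two ∪
      (oSt (n + 1)).top ∪ (oSt (n + 1)).rgt := rfl
    rw [this, Finset.card_union_of_disjoint, Finset.card_union_of_disjoint,
      Finset.card_union_of_disjoint]
    · rw [Finset.disjoint_left]
      intro w h1 h2
      obtain ⟨a, rfl⟩ := j1 w h1
      obtain ⟨k, a, hk, h⟩ := j2 _ h2
      simp at h; omega
    · rw [Finset.disjoint_left]
      intro w h1 h2
      obtain ⟨x, a', hx, h⟩ := j3 _ h2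
      rcases Finset.mem_union.1 h1 with h1 | h1
      · obtain ⟨a, rfl⟩ := j1 w h1
        simp at h; omega
      · obtain ⟨k, a, hk, rfl⟩ := j2 w h1
        simp at h; omega
    · rw [Finset.disjoint_left]
      intro w h1 h2
      obtain ⟨k', y, a', hk', hy, h⟩ := j4 _ h2
      simp only [Finset.mem_union] at h1
      rcases h1 with (h1 | h1) | h1
      · obtain ⟨a, rfl⟩ := j1 w h1
        simp at h; omega
      · obtain ⟨k, a, hk, rfl⟩ := j2 w h1
        simp at h; omega
      · obtain ⟨x, a, hx, rfl⟩ := j3 w h1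
        simp at h; omega

theorem oSt_rec : (oSt 0).all.card = 1 ∧ (oSt 1).all.card = 1 ∧ (oSt 2).all.card = 2 ∧
    ∀ n, (oSt (n + 3)).all.card = 2 * (oSt (n + 2)).all.card + (oSt n).all.card := by
  have h0 : (oSt 0).all.card = 1 := rfl
  have h1 : (oSt 0).one.card = 0 := rfl
  have h2 : (oSt 0).two.card = 0 := rfl
  have h3 : (oSt 0).top.card = 0 := rfl
  have h4 : (oSt 0).rgt.card = 0 := rfl
  have a := oSt_card_succ 0
  have b := oSt_card_succ 1
  refine ⟨h0, ?_, ?_, ?_⟩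
  · simp only [zero_add] at a; omega
  · simp only [zero_add] at a; simp only [Nat.reduceAdd] at b; omega
  · intro n
    have a := oSt_card_succ n
    have b := oSt_card_succ (n + 1)
    have c := oSt_card_succ (n + 2)
    simp only [add_assoc, Nat.reduceAdd] at a b c
    omega

theorem opR_eq_opT {n : ℕ} {w : List ℕ} (hw : w ∈ (oSt n).one) : opR n w = opT n w := by
  have hp := oSt_perm n w ((oSt_sub n).1 hw)
  obtain ⟨a, rfl⟩ := (oSt_shape n).1 w hw
  have hnd : (n :: a).Nodup := hp.nodup_iff.2 List.nodup_range
  have ha : a.map (oBump n) = a := by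
    conv_rhs => rw [← List.map_id a]
    apply List.map_congr_left
    intro b hb
    have : b ≠ n := fun h => (List.nodup_cons.1 hnd).1 (h ▸ hb)
    simp [oBump, this]
  simp [opR, opT, ha, oBump]

/-! ### Realisations of patterns by sets of indices -/

/-- `Z` lists pairs (value, index), by decreasing `x`-coordinate. -/
structure Rz (Z : List (ℕ × ℕ)) (L : List ℕ) : Prop where
  px : Z.Pairwise (fun a b => oX b.2 < oX a.2)
  py : ∀ a ∈ Z, ∀ b ∈ Z, (a.1 < b.1 ↔ oY a.2 < oY b.2)
  pi : (Z.map Prod.snd).Perm L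

def Rl (w L : List ℕ) : Prop := ∃ Z, Rz Z L ∧ Z.map Prod.fst = w

theorem Rz.mem_idx {Z : List (ℕ × ℕ)} {L : List ℕ} (h : Rz Z L) {a : ℕ × ℕ} (ha : a ∈ Z) :
    a.2 ∈ L := h.pi.mem_iff.1 (List.mem_map_of_mem ha)

theorem Rl_S {n m : ℕ} {w L : List ℕ} (hp : w.Perm (List.range (n + 1))) (h : Rl w L)
    (hm : ∀ i ∈ L, i + 1 < m ∨ (i = 0 ∧ 0 < m)) : Rl (opS n w) (m :: L) := by
  obtain ⟨Z, hZ, rfl⟩ := h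
  have hv : ∀ a ∈ Z, a.1 < n + 1 := fun a ha => by
    simpa using hp.mem_iff.1 (List.mem_map_of_mem (f := Prod.fst) ha)
  have hX : ∀ a ∈ Z, oX a.2 < oX m := fun a ha => by
    have := hm _ (hZ.mem_idx ha)
    unfold oX; split_ifs <;> first | omega | contradiction
  have hY : ∀ a ∈ Z, oY a.2 < oY m := fun a ha => by
    have := hm _ (hZ.mem_idx ha)
    unfold oY; split_ifs <;> first | omega | contradiction
  refine ⟨(n + 1, m) :: Z, ⟨?_, ?_, ?_⟩, rfl⟩
  · rw [List.pairwise_cons]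
    exact ⟨hX, hZ.px⟩
  · intro a ha b hb
    rcases List.mem_cons.1 ha with rfl | ha <;> rcases List.mem_cons.1 hb with rfl | hb
    · simp
    · have := hv b hb; have := hY b hb; constructor <;> intro h <;> simp only at * <;> omega
    · have := hv a ha; have := hY a ha; constructor <;> intro h <;> simp only at * <;> omega
    · exact hZ.py a ha b hb
  · exact hZ.pi.cons m

theorem Rl_T {n h : ℕ} {w L : List ℕ} (hp : w.Perm (List.range (n + 1))) (hR : Rl w (h :: L))
    (hL : ∀ i ∈ L, i < h) (h0 : 0 < h) (he : h % 2 = 0) : Rl (opT n w) ((h + 1) :: h :: L) := by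
  obtain ⟨Z, hZ, rfl⟩ := hR
  have hv : ∀ a ∈ Z, a.1 < n + 1 := fun a ha => by
    simpa using hp.mem_iff.1 (List.mem_map_of_mem (f := Prod.fst) ha)
  have hle : ∀ a ∈ Z, a.2 ≤ h := fun a ha => by
    rcases List.mem_cons.1 (hZ.mem_idx ha) with e | e
    · exact e.le
    · exact (hL _ e).le
  cases Z with
  | nil => have := hp.length_eq; simp at this
  | cons c Z =>
    obtain ⟨x, i⟩ := c
    have hpx := List.pairwise_cons.1 hZ.px
    have hi : i = h := by
      have : h ∈ ((x, i) :: Z).map Prod.snd := hZ.pi.mem_iff.2 (by simp)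
      rcases List.mem_cons.1 this with e | e
      · exact e.symm
      · obtain ⟨a, ha, rfl⟩ := List.mem_map.1 e
        have h1 := hpx.1 a ha
        have h2 := hle (x, i) (by simp)
        simp only at h1 h2
        unfold oX at h1
        split_ifs at h1 <;> omega
    subst hi
    have hlt : ∀ a ∈ Z, a.2 < i := fun a ha => by
      have h1 := hpx.1 a ha
      have h2 := hle a (by simp [ha])
      rcases h2.lt_or_eq with h | h
      · exact h
      · rw [h] at h1; simp at h1
    refine ⟨(x, i) :: (n + 1, i + 1) :: Z, ⟨?_, ?_, ?_⟩, rfl⟩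
    · rw [List.pairwise_cons, List.pairwise_cons]
      refine ⟨?_, ?_, hpx.2⟩
      · intro a ha
        rcases List.mem_cons.1 ha with rfl | ha
        · simp only; unfold oX; split_ifs <;> first | omega | contradiction
        · exact hpx.1 a ha
      · intro a ha
        have := hlt a ha
        simp only; unfold oX; split_ifs <;> first | omega | contradiction
    · have hY : ∀ a ∈ (x, i) :: Z, oY a.2 < oY (i + 1) := fun a ha => by
        have := hle _ ha
        unfold oY; split_ifs <;> first | omega | contradiction
      have mem : ∀ a, a ∈ (x, i) :: (n + 1, i + 1) :: Z ↔ a = (n + 1, i + 1) ∨ a ∈ (x, i) :: Z := by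
        intro a; simp only [List.mem_cons]; tauto
      intro a ha b hb
      rcases (mem a).1 ha with rfl | ha <;> rcases (mem b).1 hb with rfl | hb
      · simp
      · have := hv b hb; have := hY b hb; constructor <;> intro h <;> simp only at * <;> omega
      · have := hv a ha; have := hY a ha; constructor <;> intro h <;> simp only at * <;> omega
      · exact hZ.py a ha b hb
    · exact (List.Perm.swap _ _ _).trans (hZ.pi.cons (i + 1))

theorem Rl_R {n h : ℕ} {w L : List ℕ} (hp : w.Perm (List.range (n + 1))) (hR : Rl w (h :: L))
    (hL : ∀ i ∈ L, i < h) (he : h % 2 = 1) : Rl (opR n w) ((h + 1) :: h :: L) := by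
  obtain ⟨Z, hZ, rfl⟩ := hR
  have hv : ∀ a ∈ Z, a.1 < n + 1 := fun a ha => by
    simpa using hp.mem_iff.1 (List.mem_map_of_mem (f := Prod.fst) ha)
  have hle : ∀ a ∈ Z, a.2 ≤ h := fun a ha => by
    rcases List.mem_cons.1 (hZ.mem_idx ha) with e | e
    · exact e.le
    · exact (hL _ e).le
  have hYle : ∀ a ∈ Z, a.2 ≠ h → oY a.2 < h := fun a ha hne => by
    have := hle a ha
    unfold oY; split_ifs <;> first | omega | contradiction
  have hYh : oY h = h + 1 := by unfold oY; split_ifs <;> first | omega | contradiction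
  have hYm : oY (h + 1) = h := by unfold oY; split_ifs <;> first | omega | contradiction
  obtain ⟨b, hb, hbn⟩ : ∃ b ∈ Z, b.1 = n := by
    have : n ∈ Z.map Prod.fst := hp.mem_iff.2 (by simp)
    simpa using this
  obtain ⟨c, hc, hch⟩ : ∃ c ∈ Z, c.2 = h := by
    have : h ∈ Z.map Prod.snd := hZ.pi.mem_iff.2 (by simp)
    simpa using this
  have hcn : c.1 = n := by
    by_contra hne
    have h1 := hv c hc
    have h2 := (hZ.py c hc b hb).1 (by omega)
    rw [hch, hYh] at h2
    by_cases e : b.2 = h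
    · rw [e, hYh] at h2; omega
    · have := hYle b hb e; omega
  have iff1 : ∀ a ∈ Z, (a.1 = n → a.2 = h) := by
    intro a ha e
    by_contra hne
    have h1 := hYle a ha hne
    have h2 := (hZ.py a ha c hc).2 (by rw [hch, hYh]; omega)
    omega
  have iff2 : ∀ a ∈ Z, (a.2 = h → a.1 = n) := by
    intro a ha e
    by_contra hne
    have h1 := hv a ha
    have h2 := (hZ.py a ha c hc).1 (by omega)
    rw [hch, e] at h2
    omega
  refine ⟨(n, h + 1) :: Z.map (fun a => (oBump n a.1, a.2)), ⟨?_, ?_, ?_⟩, ?_⟩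
  · rw [List.pairwise_cons]
    constructor
    · intro a ha
      obtain ⟨a, ha', rfl⟩ := List.mem_map.1 ha
      have := hle a ha'
      simp only; unfold oX; split_ifs <;> first | omega | contradiction
    · rw [List.pairwise_map]
      exact hZ.px
  · have A : ∀ a ∈ Z, (oBump n a.1 < n ↔ oY a.2 < h) ∧ (n < oBump n a.1 ↔ h < oY a.2) := by
      intro a ha
      have h1 := hv a ha
      by_cases e : a.1 = n
      · rw [iff1 a ha e, hYh]; simp [oBump, e]
      · have e' : a.2 ≠ h := fun h => e (iff2 a ha h)
        have := hYle a ha e'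
        simp only [oBump, e, if_false]; omega
    intro a ha b hb
    rcases List.mem_cons.1 ha with rfl | ha <;> rcases List.mem_cons.1 hb with rfl | hb
    · simp
    · obtain ⟨b, hb', rfl⟩ := List.mem_map.1 hb
      simp only [hYm]; exact (A b hb').2
    · obtain ⟨a, ha', rfl⟩ := List.mem_map.1 ha
      simp only [hYm]; exact (A a ha').1
    · obtain ⟨b, hb', rfl⟩ := List.mem_map.1 hb
      obtain ⟨a, ha', rfl⟩ := List.mem_map.1 ha
      have h1 := hZ.py a ha' b hb'
      have h2 := hv a ha'
      have h3 := hv b hb'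
      simp only
      rw [← h1]
      unfold oBump
      split_ifs <;> first | omega | contradiction
  · have := hZ.pi.cons (h + 1)
    simpa [Function.comp_def] using this
  · simp [opR, Function.comp_def]

theorem countP_lt_range (k N : ℕ) : (List.range N).countP (fun x => decide (x < k)) = min k N := by
  induction N with
  | zero => simp
  | succ N ih =>
    rw [List.range_succ, List.countP_append, ih]
    by_cases h : N < k
    · simp [h]; omega
    · simp [h]; omega

theorem Rz.fst_eq {Z : List (ℕ × ℕ)} {L : List ℕ} {n : ℕ} (hZ : Rz Z L)
    (hp : (Z.map Prod.fst).Perm (List.range n)) :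
    Z.map Prod.fst = (Z.map Prod.snd).map
      (fun i => (Z.map Prod.snd).countP (fun j => decide (oY j < oY i))) := by
  rw [List.map_map]
  apply List.map_congr_left
  intro a ha
  have h1 : a.1 < n := by simpa using hp.mem_iff.1 (List.mem_map_of_mem (f := Prod.fst) ha)
  have h2 := hp.countP_eq (fun x => decide (x < a.1))
  rw [countP_lt_range, List.countP_map] at h2
  simp only [Function.comp, List.countP_map]
  rw [show a.1 = min a.1 n by omega, ← h2]
  apply List.countP_congr
  intro b hb
  simpa using hZ.py b hb a ha

theorem Rl_unique {n n' : ℕ} {w w' L : List ℕ} (h : Rl w L) (h' : Rl w' L)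
    (hp : w.Perm (List.range n)) (hp' : w'.Perm (List.range n')) : w = w' := by
  obtain ⟨Z, hZ, rfl⟩ := h
  obtain ⟨Z', hZ', rfl⟩ := h'
  have e : Z.map Prod.snd = Z'.map Prod.snd := by
    apply List.Perm.eq_of_pairwise (le := fun i j => oX j < oX i) _ _ _ (hZ.pi.trans hZ'.pi.symm)
    · intro a b _ _ h1 h2; omega
    · rw [List.pairwise_map]; exact hZ.px
    · rw [List.pairwise_map]; exact hZ'.px
  rw [hZ.fst_eq hp, hZ'.fst_eq hp', e]

theorem osc_forward (n : ℕ) : ∀ (h : ℕ) (L : List ℕ), L.length = n →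
    (h :: L).Pairwise (fun a b => b < a) → 0 ∈ h :: L →
    ∃ w ∈ (oSt n).all, Rl w (h :: L) ∧ (h = 0 ∨ w ∈ (oSt n).one ∨ w ∈ (oSt n).two ∨
      (w ∈ (oSt n).top ∧ h % 2 = 1) ∨ (w ∈ (oSt n).rgt ∧ h % 2 = 0)) := by
  induction n with
  | zero =>
    intro h L hL _ h0
    rw [List.length_eq_zero_iff] at hL
    subst hL
    have : h = 0 := (List.mem_singleton.1 h0).symm
    subst this
    exact ⟨[0], by simp [oSt], ⟨[(0, 0)], ⟨by simp, by simp, by simp⟩, rfl⟩, Or.inl rfl⟩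
  | succ n ih =>
    intro m L hL hpw h0
    cases L with
    | nil => simp at hL
    | cons h L =>
      rw [List.pairwise_cons] at hpw
      have hm : h < m := hpw.1 h (by simp)
      have h0' : 0 ∈ h :: L := by
        rcases List.mem_cons.1 h0 with e | e
        · omega
        · exact e
      obtain ⟨w, hw, hR, hst⟩ := ih h L (by simpa using hL) hpw.2 h0'
      have hlt := (List.pairwise_cons.1 hpw.2).1
      have hp := oSt_perm n w hw
      by_cases hS : h = 0 ∨ h + 1 < m
      · have hmem : opS n w ∈ (oSt (n + 1)).one := Finset.mem_image_of_mem _ hw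
        refine ⟨opS n w, (oSt_sub (n + 1)).1 hmem, ?_, Or.inr (Or.inl hmem)⟩
        apply Rl_S hp hR
        intro i hi
        rcases List.mem_cons.1 hi with rfl | hi
        · omega
        · have := hlt i hi; omega
      · have hmh : m = h + 1 := by omega
        subst hmh
        have hpos : 0 < h := by omega
        obtain ⟨sub1, sub2, sub3, sub4⟩ := oSt_sub (n + 1)
        have toTop : h % 2 = 0 → (w ∈ (oSt n).two ∨ w ∈ (oSt n).rgt) →
            ∃ w ∈ (oSt (n + 1)).all, Rl w ((h + 1) :: h :: L) ∧ (h + 1 = 0 ∨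
              w ∈ (oSt (n + 1)).one ∨ w ∈ (oSt (n + 1)).two ∨
              (w ∈ (oSt (n + 1)).top ∧ (h + 1) % 2 = 1) ∨
              (w ∈ (oSt (n + 1)).rgt ∧ (h + 1) % 2 = 0)) := by
          intro he hw'
          have hmem : opT n w ∈ (oSt (n + 1)).top :=
            Finset.mem_image_of_mem _ (Finset.mem_union.2 hw')
          exact ⟨opT n w, sub3 hmem, Rl_T hp hR hlt hpos he,
            Or.inr (Or.inr (Or.inr (Or.inl ⟨hmem, by omega⟩)))⟩
        have toRgt : h % 2 = 1 → (w ∈ (oSt n).two ∨ w ∈ (oSt n).top) →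
            ∃ w ∈ (oSt (n + 1)).all, Rl w ((h + 1) :: h :: L) ∧ (h + 1 = 0 ∨
              w ∈ (oSt (n + 1)).one ∨ w ∈ (oSt (n + 1)).two ∨
              (w ∈ (oSt (n + 1)).top ∧ (h + 1) % 2 = 1) ∨
              (w ∈ (oSt (n + 1)).rgt ∧ (h + 1) % 2 = 0)) := by
          intro he hw'
          have hmem : opR n w ∈ (oSt (n + 1)).rgt :=
            Finset.mem_image_of_mem _ (Finset.mem_union.2 hw')
          exact ⟨opR n w, sub4 hmem, Rl_R hp hR hlt he,
            Or.inr (Or.inr (Or.inr (Or.inr ⟨hmem, by omega⟩)))⟩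
        have hpar : h % 2 = 0 ∨ h % 2 = 1 := by omega
        rcases hst with e | h1 | h2 | ⟨h3, ho⟩ | ⟨h4, he⟩
        · omega
        · have hmem : opT n w ∈ (oSt (n + 1)).two := Finset.mem_image_of_mem _ h1
          refine ⟨opT n w, sub2 hmem, ?_, Or.inr (Or.inr (Or.inl hmem))⟩
          rcases hpar with he | ho
          · exact Rl_T hp hR hlt hpos he
          · rw [← opR_eq_opT h1]
            exact Rl_R hp hR hlt ho
        · rcases hpar with he | ho
          · exact toTop he (Or.inl h2)
          · exact toRgt ho (Or.inl h2)
        · exact toRgt ho (Or.inr h3)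
        · exact toTop he (Or.inr h4)

/-- `w` is realised by an index set with largest element `h`. -/
def RealAt (w : List ℕ) (h : ℕ) : Prop :=
  ∃ L : List ℕ, (h :: L).Pairwise (fun a b => b < a) ∧ 0 ∈ h :: L ∧ Rl w (h :: L)

theorem RealAt_S {n h m : ℕ} {w : List ℕ} (hp : w.Perm (List.range (n + 1))) (hR : RealAt w h)
    (hm : h + 1 < m) : RealAt (opS n w) m := by
  obtain ⟨L, h1, h2, h3⟩ := hR
  have hlt := (List.pairwise_cons.1 h1).1
  refine ⟨h :: L, List.pairwise_cons.2 ⟨?_, h1⟩, List.mem_cons_of_mem _ h2, Rl_S hp h3 ?_⟩ <;>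
  · intro i hi
    rcases List.mem_cons.1 hi with rfl | hi
    · omega
    · have := hlt i hi; omega

theorem RealAt_T {n h : ℕ} {w : List ℕ} (hp : w.Perm (List.range (n + 1))) (hR : RealAt w h)
    (h0 : 0 < h) (he : h % 2 = 0) : RealAt (opT n w) (h + 1) := by
  obtain ⟨L, h1, h2, h3⟩ := hR
  have hlt := (List.pairwise_cons.1 h1).1
  refine ⟨h :: L, List.pairwise_cons.2 ⟨?_, h1⟩, List.mem_cons_of_mem _ h2, Rl_T hp h3 hlt h0 he⟩
  intro i hi
  rcases List.mem_cons.1 hi with rfl | hi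
  · omega
  · have := hlt i hi; omega

theorem RealAt_R {n h : ℕ} {w : List ℕ} (hp : w.Perm (List.range (n + 1))) (hR : RealAt w h)
    (he : h % 2 = 1) : RealAt (opR n w) (h + 1) := by
  obtain ⟨L, h1, h2, h3⟩ := hR
  have hlt := (List.pairwise_cons.1 h1).1
  refine ⟨h :: L, List.pairwise_cons.2 ⟨?_, h1⟩, List.mem_cons_of_mem _ h2, Rl_R hp h3 hlt he⟩
  intro i hi
  rcases List.mem_cons.1 hi with rfl | hi
  · omega
  · have := hlt i hi; omega

theorem osc_backward (n : ℕ) :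
    (∀ w ∈ (oSt n).all, ∃ h, RealAt w h) ∧
    (∀ w ∈ (oSt n).one, ∀ b < 2, ∃ h, 0 < h ∧ h % 2 = b ∧ RealAt w h) ∧
    (∀ w ∈ (oSt n).two, ∀ b < 2, ∃ h, 0 < h ∧ h % 2 = b ∧ RealAt w h) ∧
    (∀ w ∈ (oSt n).top, ∃ h, h % 2 = 1 ∧ RealAt w h) ∧
    (∀ w ∈ (oSt n).rgt, ∃ h, 0 < h ∧ h % 2 = 0 ∧ RealAt w h) := by
  induction n with
  | zero =>
    refine ⟨?_, by simp [oSt], by simp [oSt], by simp [oSt], by simp [oSt]⟩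
    intro w hw
    have : w = [0] := by simpa [oSt] using hw
    subst this
    exact ⟨0, [], by simp, by simp, [(0, 0)], ⟨by simp, by simp, by simp⟩, rfl⟩
  | succ n ih =>
    obtain ⟨i0, i1, i2, i3, i4⟩ := ih
    obtain ⟨s1, s2, s3, s4⟩ := oSt_sub n
    have hp := oSt_perm n
    have H1 : ∀ w ∈ (oSt (n + 1)).one, ∀ b < 2, ∃ h, 0 < h ∧ h % 2 = b ∧ RealAt w h := by
      intro w hw b hb
      obtain ⟨v, hv, rfl⟩ := Finset.mem_image.1 hw
      obtain ⟨h, hR⟩ := i0 v hv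
      by_cases e : h % 2 = b
      · exact ⟨h + 2, by omega, by omega, RealAt_S (hp v hv) hR (by omega)⟩
      · exact ⟨h + 3, by omega, by omega, RealAt_S (hp v hv) hR (by omega)⟩
    have H2 : ∀ w ∈ (oSt (n + 1)).two, ∀ b < 2, ∃ h, 0 < h ∧ h % 2 = b ∧ RealAt w h := by
      intro w hw b hb
      obtain ⟨v, hv, rfl⟩ := Finset.mem_image.1 hw
      obtain ⟨h, h0, he, hR⟩ := i1 v hv (1 - b) (by omega)
      by_cases e : b = 1
      · exact ⟨h + 1, by omega, by omega, RealAt_T (hp v (s1 hv)) hR h0 (by omega)⟩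
      · refine ⟨h + 1, by omega, by omega, ?_⟩
        rw [← opR_eq_opT hv]
        exact RealAt_R (hp v (s1 hv)) hR (by omega)
    have H3 : ∀ w ∈ (oSt (n + 1)).top, ∃ h, h % 2 = 1 ∧ RealAt w h := by
      intro w hw
      obtain ⟨v, hv, rfl⟩ := Finset.mem_image.1 hw
      rcases Finset.mem_union.1 hv with hv | hv
      · obtain ⟨h, h0, he, hR⟩ := i2 v hv 0 (by omega)
        exact ⟨h + 1, by omega, RealAt_T (hp v (s2 hv)) hR h0 he⟩
      · obtain ⟨h, h0, he, hR⟩ := i4 v hv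
        exact ⟨h + 1, by omega, RealAt_T (hp v (s4 hv)) hR h0 he⟩
    have H4 : ∀ w ∈ (oSt (n + 1)).rgt, ∃ h, 0 < h ∧ h % 2 = 0 ∧ RealAt w h := by
      intro w hw
      obtain ⟨v, hv, rfl⟩ := Finset.mem_image.1 hw
      rcases Finset.mem_union.1 hv with hv | hv
      · obtain ⟨h, h0, he, hR⟩ := i2 v hv 1 (by omega)
        exact ⟨h + 1, by omega, by omega, RealAt_R (hp v (s2 hv)) hR he⟩
      · obtain ⟨h, he, hR⟩ := i3 v hv
        exact ⟨h + 1, by omega, by omega, RealAt_R (hp v (s3 hv)) hR he⟩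
    refine ⟨?_, H1, H2, H3, H4⟩
    intro w hw
    have hw' : w ∈ (oSt (n + 1)).one ∪ (oSt (n + 1)).two ∪
      (oSt (n + 1)).top ∪ (oSt (n + 1)).rgt := hw
    simp only [Finset.mem_union] at hw'
    rcases hw' with ((h | h) | h) | h
    · obtain ⟨k, -, -, hk⟩ := H1 w h 0 (by omega); exact ⟨k, hk⟩
    · obtain ⟨k, -, -, hk⟩ := H2 w h 0 (by omega); exact ⟨k, hk⟩
    · obtain ⟨k, -, hk⟩ := H3 w h; exact ⟨k, hk⟩
    · obtain ⟨k, -, -, hk⟩ := H4 w h; exact ⟨k, hk⟩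

/-! ### The class in terms of realisations -/

theorem exists_desc (l : List ℕ) (hl : l.Nodup) :
    ∃ L : List ℕ, l.Perm L ∧ L.Pairwise (fun a b => b < a) := by
  refine ⟨l.insertionSort (· ≥ ·), (List.perm_insertionSort _ l).symm, ?_⟩
  have h1 := List.pairwise_insertionSort (· ≥ ·) l
  have h2 : (l.insertionSort (· ≥ ·)).Nodup := (List.perm_insertionSort _ l).nodup_iff.2 hl
  exact (h1.and h2).imp (fun h => lt_of_le_of_ne h.1 (Ne.symm h.2))

theorem osc_mem_forward {p : CPerm} (hp : p ∈ IncreasingOscillations) :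
    p.origin = 0 ∧ p.vals.Perm (List.range p.vals.length) ∧
      ∃ L : List ℕ, L.Pairwise (fun a b => b < a) ∧ 0 ∈ L ∧ Rl p.vals.reverse L := by
  obtain ⟨⟨hne, hor, hperm⟩, n, f, f1, f2, f3, f4⟩ := hp
  obtain ⟨idx, q1, q2, q3, q4, q5, q6, q7⟩ := pinPerm_osc_spec n
  rw [q1] at f2
  rw [q2] at f3
  have hpos : 0 < p.vals.length := by omega
  have ho : p.origin = 0 := by
    by_contra h
    have := f1 0 p.origin hpos hor (by omega)
    omega
  rw [ho] at f3
  set Z := (List.range p.vals.length).map (fun i => (p.valAt i, idx (f i))) with hZ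
  have hpx : Z.Pairwise (fun a b => oX a.2 < oX b.2) := by
    rw [hZ, List.pairwise_map, List.pairwise_iff_getElem]
    intro i j hi hj hij
    simp only [List.getElem_range]
    simp only [List.length_range] at hi hj
    exact q5 _ _ (f1 i j hi hj hij) (f2 j hj)
  have hfst : Z.map Prod.fst = p.vals := by
    apply List.ext_getElem
    · simp [hZ]
    · intro i h1 h2
      simp [hZ, CPerm.valAt, h2]
  have hnd : (Z.reverse.map Prod.snd).Nodup := by
    rw [List.map_reverse, List.nodup_reverse]
    unfold List.Nodup
    rw [List.pairwise_map]
    refine hpx.imp ?_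
    intro a b h e
    rw [e] at h
    exact lt_irrefl _ h
  obtain ⟨L, hL1, hL2⟩ := exists_desc _ hnd
  refine ⟨ho, hperm, L, hL2, ?_, Z.reverse, ⟨?_, ?_, hL1⟩, ?_⟩
  · rw [← hL1.mem_iff]
    simp only [List.map_reverse, List.mem_reverse, hZ, List.map_map, List.mem_map, List.mem_range]
    exact ⟨0, hpos, by simp [f3, q3]⟩
  · rw [List.pairwise_reverse]; exact hpx
  · intro a ha b hb
    simp only [List.mem_reverse, hZ, List.mem_map, List.mem_range] at ha hb
    obtain ⟨i, hi, rfl⟩ := ha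
    obtain ⟨j, hj, rfl⟩ := hb
    simp only
    rw [f4 i j hi hj, q6 _ _ (f2 i hi) (f2 j hj)]
  · rw [List.map_reverse, hfst]

theorem osc_mem_backward {w : List ℕ} {n h : ℕ} (hw : w.Perm (List.range (n + 1)))
    (hR : RealAt w h) : (⟨w.reverse, 0⟩ : CPerm) ∈ IncreasingOscillations := by
  obtain ⟨L, hL, h0, Z, hZ, rfl⟩ := hR
  have hlen : Z.length = n + 1 := by simpa using hw.length_eq
  refine ⟨⟨?_, ?_, ?_⟩, h, ?_⟩
  · intro e
    have := congrArg List.length e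
    simp [hlen] at this
  · simp [hlen]
  · simp only [List.length_reverse, List.length_map, hlen]
    exact (List.reverse_perm _).trans hw
  · obtain ⟨idx, q1, q2, q3, q4, q5, q6, q7⟩ := pinPerm_osc_spec h
    have hle : ∀ a ∈ Z, a.2 < h + 2 := fun a ha => by
      rcases List.mem_cons.1 (hZ.mem_idx ha) with e | e
      · omega
      · have := (List.pairwise_cons.1 hL).1 _ e; omega
    set Y := Z.reverse with hY
    have hYlen : Y.length = n + 1 := by simp [hY, hlen]
    have hYm : ∀ a, a ∈ Y ↔ a ∈ Z := by simp [hY]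
    have hYx : Y.Pairwise (fun a b => oX a.2 < oX b.2) := by
      rw [hY, List.pairwise_reverse]; exact hZ.px
    have hex : ∀ i, ∃ k, ∀ hi : i < Y.length, k < h + 2 ∧ idx k = Y[i].2 := by
      intro i
      by_cases hi : i < Y.length
      · obtain ⟨k, hk⟩ := q7 _ (hle _ ((hYm _).1 (List.getElem_mem hi)))
        exact ⟨k, fun _ => hk⟩
      · exact ⟨0, fun h' => absurd h' hi⟩
    choose f hf using hex
    have hvl : (⟨(Z.map Prod.fst).reverse, 0⟩ : CPerm).vals = Y.map Prod.fst := by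
      simp [hY]
    have hval : ∀ i (hi : i < Y.length),
        (⟨(Z.map Prod.fst).reverse, 0⟩ : CPerm).valAt i = Y[i].1 := by
      intro i hi
      unfold CPerm.valAt
      rw [hvl, List.getD_eq_getElem _ _ (by simpa using hi), List.getElem_map]
    refine ⟨f, ?_, ?_, ?_, ?_⟩
    · rw [hvl, List.length_map]
      intro i j hi hj hij
      by_contra hc
      have h1 := List.pairwise_iff_getElem.1 hYx i j hi hj hij
      rw [← (hf i hi).2, ← (hf j hj).2] at h1
      rcases (not_lt.1 hc).lt_or_eq with e | e
      · have := q5 _ _ e (hf i hi).1; omega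
      · rw [e] at h1; omega
    · rw [hvl, List.length_map, q1]
      intro i hi
      exact (hf i hi).1
    · rw [q2]
      show f 0 = 0
      have hY0 : 0 < Y.length := by omega
      have h00 : Y[0].2 = 0 := by
        have : 0 ∈ Z.map Prod.snd := hZ.pi.mem_iff.2 h0
        obtain ⟨a, ha, ha0⟩ := List.mem_map.1 this
        obtain ⟨i, hi, e⟩ := List.getElem_of_mem ((hYm a).2 ha)
        rcases Nat.eq_zero_or_pos i with rfl | hp
        · rw [e, ha0]
        · have h1 := List.pairwise_iff_getElem.1 hYx 0 i hY0 hi hp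
          rw [e, ha0] at h1
          simp [oX] at h1
      by_contra hc
      have h1 := q5 0 (f 0) (by omega) (hf 0 hY0).1
      rw [(hf 0 hY0).2, h00, q3] at h1
      omega
    · rw [hvl, List.length_map]
      intro i j hi hj
      rw [hval i hi, hval j hj, q6 _ _ (hf i hi).1 (hf j hj).1, (hf i hi).2, (hf j hj).2]
      exact hZ.py _ ((hYm _).1 (List.getElem_mem hi)) _ ((hYm _).1 (List.getElem_mem hj))

theorem osc_count (n : ℕ) : CPerm.count IncreasingOscillations n = (oSt n).all.card := by
  have hset : {p | p ∈ IncreasingOscillations ∧ p.len = n} =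
      (((oSt n).all.image (fun w => (⟨w.reverse, 0⟩ : CPerm)) : Finset CPerm) : Set CPerm) := by
    ext p
    simp only [Set.mem_setOf_eq, Finset.coe_image, Set.mem_image, Finset.mem_coe]
    constructor
    · rintro ⟨hp, hlen⟩
      have hne := hp.1.1
      obtain ⟨ho, hperm, L, hL, h0, hR⟩ := osc_mem_forward hp
      have hl : p.vals.length = n + 1 := by
        have := List.length_pos_iff.2 hne
        unfold CPerm.len at hlen
        omega
      rw [hl] at hperm
      have hLlen : L.length = n + 1 := by
        obtain ⟨Z, hZ, e⟩ := hR
        have h1 := congrArg List.length e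
        have h2 := hZ.pi.length_eq
        simp at h1 h2
        omega
      cases L with
      | nil => simp at hLlen
      | cons h L =>
        obtain ⟨w, hw, hRw, -⟩ := osc_forward n h L (by simpa using hLlen) hL h0
        have e := Rl_unique hRw hR (oSt_perm n w hw) ((List.reverse_perm _).trans hperm)
        refine ⟨w, hw, ?_⟩
        rw [e, List.reverse_reverse, ← ho]
    · rintro ⟨w, hw, rfl⟩
      have hperm := oSt_perm n w hw
      obtain ⟨h, hR⟩ := (osc_backward n).1 w hw
      refine ⟨osc_mem_backward hperm hR, ?_⟩
      have := hperm.length_eq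
      simp at this
      simp [CPerm.len, this]
  unfold CPerm.count
  rw [hset, Set.ncard_coe_finset]
  apply Finset.card_image_of_injective
  intro v w h
  simpa using h

/-- `O°` has generating function `(1−z)/(1−2z−z³)`, and its
growth rate `κ ≈ 2.20557` is the reciprocal of the smallest positive real root
of `1 − 2z − z³ = 0`. -/
theorem increasing_oscillations_genfun_and_growth :
    (PowerSeries.mk fun n => (CPerm.count IncreasingOscillations n : ℝ)) *
        (1 - 2 * (PowerSeries.X : PowerSeries ℝ) - (PowerSeries.X : PowerSeries ℝ) ^ 3) =
      1 - (PowerSeries.X : PowerSeries ℝ) ∧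
    ∀ α : ℝ, 0 < α → 1 - 2 * α - α ^ 3 = 0 →
      (∀ β : ℝ, 0 < β → 1 - 2 * β - β ^ 3 = 0 → α ≤ β) →
      Tendsto (fun n : ℕ => ((CPerm.count IncreasingOscillations n : ℝ)) ^ ((n : ℝ)⁻¹))
        atTop (nhds α⁻¹) := by
  obtain ⟨h0, h1, h2, hr⟩ := oSt_rec
  simp only [osc_count]
  exact ⟨osc_genfun_aux _ h0 h1 h2 hr,
    fun α hα hroot _ => osc_growth_aux (fun n => (oSt n).all.card) h0 h1 h2 hr α hα hroot⟩
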